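/- For every n ≥ 1 and every multi-index β ∈ ℕⁿ, ∑_{γ : 2γ ≤ β} √(β!) / ( γ! (β − 2γ)! ) ≤ 2^{|β| + n}, where the sum is over all multi-indices γ with 2γ_j ≤ β_j for every j. -/

import Mathlib

open Finset
open scoped Nat

/-- Length `|β|` of a multi-index. -/
def deg {n : ℕ} (β : Fin n → ℕ) : ℕ := ∑ i, β i

/-- Factorial `β!` of a multi-index. -/
def mfact {n : ℕ} (β : Fin n → ℕ) : ℕ := ∏ i, (β i)!

theorem factorial_le_two_pow_mul_sq (g a : ℕ) :
    (2 * g + a)! ≤ 2 ^ (2 * g + a) * 4 ^ g * (g ! * a !) ^ 2 := by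
  have h₁ : (2 * g + a).choose (2 * g) * (2 * g)! * a ! = (2 * g + a)! := by
    simpa using Nat.choose_mul_factorial_mul_factorial (Nat.le_add_right (2 * g) a)
  have h₂ : (2 * g).choose g * g ! * g ! = (2 * g)! := by
    have h := Nat.choose_mul_factorial_mul_factorial (show g ≤ 2 * g by omega)
    rwa [show 2 * g - g = g by omega] at h
  have h₃ : (2 * g + a).choose (2 * g) ≤ 2 ^ (2 * g + a) := Nat.choose_le_two_pow _ _
  have h₄ : (2 * g).choose g ≤ 4 ^ g := by
    simpa [pow_mul] using Nat.choose_le_two_pow (2 * g) g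
  calc (2 * g + a)! = (2 * g + a).choose (2 * g) * (2 * g).choose g * (g ! * g ! * a !) := by
        rw [← h₁, ← h₂]; ring
    _ ≤ 2 ^ (2 * g + a) * 4 ^ g * (g ! * g ! * (a ! * a !)) := by
        gcongr
        exact Nat.le_mul_of_pos_left _ (Nat.factorial_pos a)
    _ = 2 ^ (2 * g + a) * 4 ^ g * (g ! * a !) ^ 2 := by ring

theorem sqrt_factorial_div_le {b g : ℕ} (hg : g ≤ b / 2) :
    Real.sqrt (b ! : ℝ) / ((g ! : ℝ) * ((b - 2 * g)! : ℝ)) ≤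
      2 ^ b * (1 / 2) ^ (b / 2 - g) := by
  have hpos : (0 : ℝ) < (g ! : ℝ) * ((b - 2 * g)! : ℝ) := by positivity
  rw [div_le_iff₀ hpos]
  apply Real.sqrt_le_iff.2 ⟨by positivity, ?_⟩
  have h₁ := factorial_le_two_pow_mul_sq g (b - 2 * g)
  rw [show 2 * g + (b - 2 * g) = b by omega] at h₁
  have h₂ : (b ! : ℝ) ≤ 2 ^ b * 4 ^ g * ((g ! : ℝ) * ((b - 2 * g)! : ℝ)) ^ 2 := by
    exact_mod_cast h₁
  refine h₂.trans ?_
  rw [mul_pow _ ((g ! : ℝ) * _)]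
  gcongr
  have h₃ : (4 : ℝ) ^ g * 4 ^ (b / 2 - g) ≤ 2 ^ b := by
    rw [← pow_add, show (4 : ℝ) = 2 ^ 2 by norm_num, ← pow_mul]
    exact pow_le_pow_right₀ (by norm_num) (by omega)
  have h₄ : ((1 / 2 : ℝ) ^ (b / 2 - g)) ^ 2 = 1 / 4 ^ (b / 2 - g) := by
    rw [← pow_mul, mul_comm, pow_mul, ← one_div_pow]
    norm_num
  rw [mul_pow, h₄, sq, mul_assoc, mul_one_div]
  gcongr
  rwa [le_div_iff₀ (by positivity)]

theorem sum_sqrt_factorial_div_le (b : ℕ) :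
    ∑ g ∈ Finset.range (b / 2 + 1),
      Real.sqrt (b ! : ℝ) / ((g ! : ℝ) * ((b - 2 * g)! : ℝ)) ≤ 2 ^ (b + 1) := by
  calc _ ≤ ∑ g ∈ Finset.range (b / 2 + 1), (2 : ℝ) ^ b * (1 / 2) ^ (b / 2 - g) :=
        Finset.sum_le_sum fun g hg =>
          sqrt_factorial_div_le (Nat.lt_succ_iff.1 (Finset.mem_range.1 hg))
    _ = 2 ^ b * ∑ k ∈ Finset.range (b / 2 + 1), (1 / 2 : ℝ) ^ k := by
        rw [← Finset.mul_sum, ← Finset.sum_range_reflect (fun k => (1 / 2 : ℝ) ^ k)]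
        simp
    _ ≤ 2 ^ b * 2 := by
        gcongr
        exact sum_geometric_two_le _
    _ = 2 ^ (b + 1) := (pow_succ _ _).symm

/-- For every multi-index `β ∈ ℕⁿ`,
`∑_{2γ ≤ β} √(β!)/(γ!(β−2γ)!) ≤ 2^{|β|+n}`. -/
theorem statement13 (n : ℕ) (hn : 1 ≤ n) (β : Fin n → ℕ) :
    ∑ γ ∈ Fintype.piFinset (fun i => Finset.range (β i / 2 + 1)),
      Real.sqrt (mfact β : ℝ) /
        ((mfact γ : ℝ) * (mfact (fun i => β i - 2 * γ i) : ℝ)) ≤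
      2 ^ (deg β + n) := by
  calc _ = ∏ i, ∑ g ∈ Finset.range (β i / 2 + 1),
        Real.sqrt ((β i)! : ℝ) / ((g ! : ℝ) * ((β i - 2 * g)! : ℝ)) := by
        rw [Finset.prod_univ_sum]
        refine Finset.sum_congr rfl fun γ _ => ?_
        simp only [mfact, Nat.cast_prod]
        rw [Real.sqrt_prod _ fun i _ => Nat.cast_nonneg _, Finset.prod_div_distrib,
          Finset.prod_mul_distrib]
    _ ≤ ∏ i, (2 : ℝ) ^ (β i + 1) :=
        Finset.prod_le_prod (fun i _ => Finset.sum_nonneg fun g _ => by positivity)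
          fun i _ => sum_sqrt_factorial_div_le (β i)
    _ = 2 ^ (deg β + n) := by
        rw [Finset.prod_pow_eq_pow_sum, Finset.sum_add_distrib]
        simp [deg]
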